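/- Let X₀ ~ Gamma(α,β), let ζ be independent of X₀ with characteristic function [(β-iω)/(β-iρω)]^{-α} where 0 ≤ ρ < 1, and set X₁ = ρX₀ + ζ. Then X₁ ~ Gamma(α,β) and the joint characteristic function is E exp(isX₀ + itX₁) = [ (1 - i(s+ρt)/β)(1 - it/β) / (1 - itρ/β) ]^{-α}. -/

import Mathlib

open MeasureTheory ProbabilityTheory Complex

namespace ProbabilityTheory

lemma measurable_gammaPDF (a r : ℝ) : Measurable (gammaPDF a r) :=
  (measurable_gammaPDFReal a r).ennreal_ofReal

lemma integrable_gammaPDFReal {a r : ℝ} (ha : 0 < a) (hr : 0 < r) :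
    Integrable (gammaPDFReal a r) := by
  refine ⟨(measurable_gammaPDFReal a r).aestronglyMeasurable, ?_⟩
  rw [hasFiniteIntegral_iff_ofReal (ae_of_all _ (gammaPDFReal_nonneg ha hr))]
  change ∫⁻ x, gammaPDF a r x < _
  simp [lintegral_gammaPDF_eq_one ha hr]

lemma integral_gammaPDFReal {a r : ℝ} (ha : 0 < a) (hr : 0 < r) :
    ∫ x, gammaPDFReal a r x = 1 := by
  rw [integral_eq_lintegral_of_nonneg_ae (ae_of_all _ (gammaPDFReal_nonneg ha hr))
    (measurable_gammaPDFReal a r).aestronglyMeasurable]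
  change (∫⁻ x, gammaPDF a r x).toReal = 1
  simp [lintegral_gammaPDF_eq_one ha hr]

/-- Exponential tilting of a gamma density changes its rate. -/
lemma gammaPDFReal_mul_exp {a r t : ℝ} (hr : 0 < r) (ht : t < r) (x : ℝ) :
    gammaPDFReal a r x * Real.exp (t * x) =
      (1 - t / r) ^ (-a) * gammaPDFReal a (r - t) x := by
  have hrt : 0 < r - t := sub_pos.2 ht
  have h1 : 1 - t / r = (r - t) / r := by field_simp
  unfold gammaPDFReal
  split_ifs
  · rw [h1, Real.rpow_neg (by positivity), Real.div_rpow hrt.le hr.le, mul_assoc _ (Real.exp _),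
      ← Real.exp_add, show -(r * x) + t * x = -((r - t) * x) by ring]
    have := (Real.rpow_pos_of_pos hrt a).ne'
    have := (Real.rpow_pos_of_pos hr a).ne'
    field_simp
  · simp

lemma Iio_subset_integrableExpSet_gammaMeasure {a r : ℝ} (ha : 0 < a) (hr : 0 < r) :
    Set.Iio r ⊆ integrableExpSet id (gammaMeasure a r) := by
  intro t ht
  change Integrable _ (volume.withDensity (gammaPDF a r))
  rw [integrable_withDensity_iff_integrable_smul' (measurable_gammaPDF a r)
    (ae_of_all _ fun _ ↦ ENNReal.ofReal_lt_top)]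
  refine ((integrable_gammaPDFReal ha (sub_pos.2 ht)).const_mul ((1 - t / r) ^ (-a))).congr
    (ae_of_all _ fun x ↦ ?_)
  simp only [gammaPDF, ENNReal.toReal_ofReal (gammaPDFReal_nonneg ha hr x), smul_eq_mul, id_eq]
  exact (gammaPDFReal_mul_exp hr ht x).symm

lemma mgf_id_gammaMeasure {a r t : ℝ} (ha : 0 < a) (hr : 0 < r) (ht : t < r) :
    mgf id (gammaMeasure a r) t = (1 - t / r) ^ (-a) := by
  rw [mgf, gammaMeasure, integral_withDensity_eq_integral_toReal_smul (measurable_gammaPDF a r)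
    (ae_of_all _ fun _ ↦ ENNReal.ofReal_lt_top)]
  simp only [gammaPDF, ENNReal.toReal_ofReal (gammaPDFReal_nonneg ha hr _), smul_eq_mul, id_eq,
    gammaPDFReal_mul_exp hr ht]
  rw [integral_const_mul, integral_gammaPDFReal ha (sub_pos.2 ht), mul_one]

lemma complexMGF_id_gammaMeasure {a r : ℝ} (ha : 0 < a) (hr : 0 < r) {z : ℂ} (hz : z.re < r) :
    complexMGF id (gammaMeasure a r) z = (1 - z / r) ^ (-(a : ℂ)) := by
  have hopen : IsOpen {z : ℂ | z.re < r} := isOpen_lt continuous_re continuous_const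
  have hf : AnalyticOnNhd ℂ (complexMGF id (gammaMeasure a r)) {z | z.re < r} :=
    analyticOnNhd_complexMGF.mono fun w hw ↦
      interior_maximal (Iio_subset_integrableExpSet_gammaMeasure ha hr) isOpen_Iio hw
  have hg : AnalyticOnNhd ℂ (fun z : ℂ ↦ (1 - z / r) ^ (-(a : ℂ))) {z | z.re < r} := by
    refine DifferentiableOn.analyticOnNhd (fun w hw ↦ ?_) hopen
    refine DifferentiableAt.differentiableWithinAt (DifferentiableAt.cpow_const (by fun_prop) ?_)
    left
    simpa [div_lt_one hr] using hw
  refine hf.eqOn_of_preconnected_of_frequently_eq hg (convex_halfSpace_re_lt r).isPreconnected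
    (z₀ := 0) (by simpa using hr) ?_ hz
  have hreal : ∀ᶠ t : ℝ in nhdsWithin 0 {0}ᶜ, complexMGF id (gammaMeasure a r) t =
      (1 - (t : ℂ) / r) ^ (-(a : ℂ)) := by
    filter_upwards [mem_nhdsWithin_of_mem_nhds (Iio_mem_nhds hr)] with t ht
    have : 0 ≤ 1 - t / r := by
      rw [sub_nonneg, div_le_one hr]
      exact le_of_lt ht
    rw [complexMGF_ofReal, mgf_id_gammaMeasure ha hr ht, ofReal_cpow this]
    push_cast
    rfl
  have htendsto : Filter.Tendsto ((↑) : ℝ → ℂ) (nhdsWithin 0 {0}ᶜ) (nhdsWithin 0 {0}ᶜ) := by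
    refine tendsto_nhdsWithin_iff.2 ⟨?_, ?_⟩
    · exact (continuous_ofReal.tendsto' 0 0 ofReal_zero).mono_left nhdsWithin_le_nhds
    · filter_upwards [self_mem_nhdsWithin] with t ht
      simpa using ht
  exact htendsto.frequently hreal.frequently

lemma charFun_gammaMeasure {a r : ℝ} (ha : 0 < a) (hr : 0 < r) (t : ℝ) :
    charFun (gammaMeasure a r) t = (1 - t * I / r) ^ (-(a : ℂ)) := by
  rw [← complexMGF_id_mul_I, complexMGF_id_gammaMeasure ha hr (by simpa using hr)]

end ProbabilityTheory

lemma Complex.mul_cpow_of_re_pos {u v : ℂ} (hu : 0 < u.re) (hv : 0 < v.re) (z : ℂ) :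
    (u * v) ^ z = u ^ z * v ^ z := by
  have hu0 : u ≠ 0 := by rintro rfl; simp at hu
  have hv0 : v ≠ 0 := by rintro rfl; simp at hv
  have hau := abs_lt.1 (abs_arg_lt_pi_div_two_iff.2 (.inl hu))
  have hav := abs_lt.1 (abs_arg_lt_pi_div_two_iff.2 (.inl hv))
  have hlog : log (u * v) = log u + log v :=
    (log_mul_eq_add_log_iff hu0 hv0).2 ⟨by linarith, by linarith⟩
  rw [cpow_def_of_ne_zero (mul_ne_zero hu0 hv0), cpow_def_of_ne_zero hu0, cpow_def_of_ne_zero hv0,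
    hlog, add_mul, exp_add]

theorem gamma_ar1_step
    {Ω : Type*} [MeasurableSpace Ω] (P : Measure Ω) [IsProbabilityMeasure P]
    (α β ρ : ℝ) (hα : 0 < α) (hβ : 0 < β) (hρ₀ : 0 ≤ ρ) (hρ₁ : ρ < 1)
    (X₀ ζ : Ω → ℝ) (hX₀ : Measurable X₀) (hζ : Measurable ζ)
    (hindep : IndepFun X₀ ζ P)
    (hX₀law : Measure.map X₀ P = gammaMeasure α β)
    (hζchf : ∀ ω : ℝ,
      (∫ w, Complex.exp (I * ω * ζ w) ∂P) =
        (((β : ℂ) - I * ω) / ((β : ℂ) - I * ρ * ω)) ^ (-(α : ℂ)))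
    (X₁ : Ω → ℝ) (hX₁ : X₁ = fun w => ρ * X₀ w + ζ w) :
    Measure.map X₁ P = gammaMeasure α β ∧
      ∀ s t : ℝ,
        (∫ w, Complex.exp (I * (s * X₀ w + t * X₁ w)) ∂P) =
          ((1 - I * (s + ρ * t) / β) * (1 - I * t / β) / (1 - I * t * ρ / β))
            ^ (-(α : ℂ)) := by
  have hβ' : (β : ℂ) ≠ 0 := ofReal_ne_zero.2 hβ.ne'
  have hne (x : ℝ) : (β : ℂ) - I * x ≠ 0 := fun h ↦ hβ.ne' (by simpa using congrArg re h)
  have hX₀chf (u : ℝ) : ∫ w, exp (I * u * X₀ w) ∂P = (1 - I * u / β) ^ (-(α : ℂ)) := by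
    have h := charFun_gammaMeasure hα hβ u
    rw [← hX₀law, charFun_apply_real, integral_map hX₀.aemeasurable (by fun_prop)] at h
    simpa only [mul_comm, mul_left_comm, mul_assoc] using h
  have hquot (t : ℝ) : 0 < (((β : ℂ) - I * t) / ((β : ℂ) - I * ρ * t)).re := by
    have hn : (β : ℂ) - I * ρ * t ≠ 0 := by simpa [mul_assoc] using hne (ρ * t)
    rw [div_re, ← add_div]
    refine div_pos ?_ (normSq_pos.2 hn)
    have : 0 ≤ t * (ρ * t) := by nlinarith [mul_nonneg hρ₀ (mul_self_nonneg t)]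
    simp
    nlinarith [mul_pos hβ hβ]
  have hjoint (s t : ℝ) : ∫ w, exp (I * (s * X₀ w + t * X₁ w)) ∂P =
      ((1 - I * (s + ρ * t) / β) * (1 - I * t / β) / (1 - I * t * ρ / β)) ^ (-(α : ℂ)) := by
    have hsplit (w : Ω) : exp (I * (s * X₀ w + t * X₁ w)) =
        exp (I * (s + ρ * t : ℝ) * X₀ w) * exp (I * t * ζ w) := by
      rw [hX₁, ← exp_add]
      push_cast
      ring_nf
    simp_rw [hsplit]
    rw [hindep.integral_fun_comp_mul_comp (f := fun x : ℝ ↦ exp (I * (s + ρ * t : ℝ) * x))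
      (g := fun x : ℝ ↦ exp (I * t * x)) hX₀.aemeasurable hζ.aemeasurable (by fun_prop)
      (by fun_prop), hX₀chf, hζchf, ← mul_cpow_of_re_pos (by simp) (hquot t)]
    rw [mul_div_assoc (1 - _) (1 - _), one_sub_div hβ' (a := I * t), one_sub_div hβ' (a := I * t * ρ),
      div_div_div_cancel_right₀ hβ', mul_right_comm I (t : ℂ) (ρ : ℂ)]
    push_cast
    rfl
  refine ⟨?_, hjoint⟩
  have hX₁m : Measurable X₁ := hX₁ ▸ (hX₀.const_mul ρ).add hζ
  have := isProbabilityMeasure_gammaMeasure hα hβ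
  have := Measure.isProbabilityMeasure_map (μ := P) hX₁m.aemeasurable
  refine Measure.ext_of_charFun (funext fun t ↦ ?_)
  rw [charFun_gammaMeasure hα hβ, charFun_apply_real, integral_map hX₁m.aemeasurable (by fun_prop)]
  have hn : 1 - I * t * ρ / β ≠ 0 := by
    rw [one_sub_div hβ']
    exact div_ne_zero (by simpa [mul_assoc, mul_comm (t : ℂ)] using hne (ρ * t)) hβ'
  have h := hjoint 0 t
  rw [ofReal_zero, zero_add, show I * (ρ * t : ℂ) = I * t * ρ by ring,
    mul_div_cancel_left₀ _ hn] at h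
  simpa [mul_comm, mul_left_comm, mul_assoc] using h
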